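/- Let $1 < p < \infty$ and let $D \subset L^p(\mathcal{R})\times L^p(\mathcal{R})$ be closed, convex, and bounded. Suppose $S : D \to V$ is weakly sequentially continuous into a Banach space $V$, $B : V \to W$ is a bounded linear operator to a Banach space $W$, $\alpha > 0$, and $(x^n)$ is a sequence of minimizers of $J_n(x) = \|BS(x) - \mathcal{M}^n\|_W^q + \alpha\|x - x_0\|^p$ where $\mathcal{M}^n \to \mathcal{M}$ in $W$. Then $(x^n)$ has a subsequence converging weakly to a minimizer $x_\alpha$ of $J(x) = \|BS(x) - \mathcal{M}\|_W^q + \alpha\|x - x_0\|^p$, and along this subsequence $\|x^n - x_0\| \to \|x_\alpha - x_0\|$. -/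

import Mathlib

open MeasureTheory Filter
open scoped ENNReal

section LpDuality

variable {X : Type*} [MeasurableSpace X] {μ : Measure X} [IsFiniteMeasure μ]

theorem hasSum_indicatorConstLp_iUnion {p : ℝ≥0∞} [Fact (1 ≤ p)] (hp : p ≠ ∞) {A : ℕ → Set X}
    (hA : ∀ i, MeasurableSet (A i)) (hdisj : Pairwise (Function.onFun Disjoint A)) :
    HasSum (fun i => indicatorConstLp p (hA i) (measure_ne_top μ _) (1 : ℝ))
      (indicatorConstLp p (MeasurableSet.iUnion hA) (measure_ne_top μ _) (1 : ℝ)) := by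
  have hmeas (F : Finset ℕ) : MeasurableSet (⋃ i ∈ F, A i) :=
    Finset.measurableSet_biUnion F fun i _ => hA i
  have hsum (F : Finset ℕ) : ∑ i ∈ F, indicatorConstLp p (hA i) (measure_ne_top μ _) (1 : ℝ) =
      indicatorConstLp p (hmeas F) (measure_ne_top μ _) (1 : ℝ) := by
    induction F using Finset.induction_on with
    | empty => simp
    | insert a F ha ih =>
      have hd : Disjoint (A a) (⋃ i ∈ F, A i) := by
        rw [Set.disjoint_iUnion₂_right]
        exact fun i hi => hdisj (fun h => ha (h ▸ hi))
      rw [Finset.sum_insert ha, ih, ← indicatorConstLp_disjoint_union _ _ _ _ hd]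
      congr 1
      simp
  rw [HasSum]
  simp_rw [hsum]
  apply tendsto_indicatorConstLp_set hp
  have hdiff (F : Finset ℕ) : μ (symmDiff (⋃ i ∈ F, A i) (⋃ i, A i)) =
      μ (⋃ i, A i) - ∑ i ∈ F, μ (A i) := by
    have hsub : (⋃ i ∈ F, A i) ⊆ ⋃ i, A i := Set.iUnion₂_subset_iUnion _ _
    rw [symmDiff_of_le hsub, measure_sdiff hsub (hmeas F).nullMeasurableSet (measure_ne_top μ _),
      measure_biUnion_finset (fun i _ j _ hij => hdisj hij) (fun i _ => hA i)]
  simp_rw [hdiff]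
  have hlim : Tendsto (fun F : Finset ℕ => ∑ i ∈ F, μ (A i)) atTop (nhds (μ (⋃ i, A i))) := by
    rw [measure_iUnion hdisj hA]
    exact ENNReal.summable.hasSum
  simpa using ENNReal.Tendsto.sub (tendsto_const_nhds (x := μ (⋃ i, A i))) hlim
    (Or.inl (measure_ne_top μ _))

theorem exists_integrable_density {p : ℝ≥0∞} [Fact (1 ≤ p)] (hp : p ≠ ∞)
    (f : StrongDual ℝ (Lp ℝ p μ)) :
    ∃ g : X → ℝ, Measurable g ∧ Integrable g μ ∧ ∀ (s : Set X) (hs : MeasurableSet s),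
      f (indicatorConstLp p hs (measure_ne_top μ _) (1 : ℝ)) = ∫ x in s, g x ∂μ := by
  classical
  let ν : SignedMeasure X :=
    { measureOf' := fun s => if hs : MeasurableSet s then
        f (indicatorConstLp p hs (measure_ne_top μ _) (1 : ℝ)) else 0
      empty' := by simp
      not_measurable' := fun s hs => by simp [hs]
      m_iUnion' := fun A hA hd => by
        simp only [hA, MeasurableSet.iUnion hA, dif_pos]
        exact (hasSum_indicatorConstLp_iUnion hp hA hd).mapL f }
  have hν (s : Set X) (hs : MeasurableSet s) :
      ν s = f (indicatorConstLp p hs (measure_ne_top μ _) (1 : ℝ)) := by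
    change (if hs : MeasurableSet s then
        f (indicatorConstLp p hs (measure_ne_top μ _) (1 : ℝ)) else 0) = _
    rw [dif_pos hs]
  have hac : VectorMeasure.AbsolutelyContinuous ν μ.toENNRealVectorMeasure := by
    refine VectorMeasure.AbsolutelyContinuous.mk fun s hs h0 => ?_
    rw [Measure.toENNRealVectorMeasure_apply_measurable hs] at h0
    have : indicatorConstLp p hs (measure_ne_top μ _) (1 : ℝ) = 0 := by
      rw [← indicatorConstLp_empty (p := p) (μ := μ) (c := (1 : ℝ)),
        indicatorConstLp_inj _ _ _ _ one_ne_zero]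
      exact ae_eq_empty.2 h0
    rw [hν s hs, this, map_zero]
  have hint : Integrable (ν.rnDeriv μ) μ := SignedMeasure.integrable_rnDeriv ν μ
  refine ⟨ν.rnDeriv μ, SignedMeasure.measurable_rnDeriv ν μ, hint, fun s hs => ?_⟩
  rw [← hν s hs, ← withDensityᵥ_apply hint hs, SignedMeasure.withDensityᵥ_rnDeriv_eq ν μ hac]

theorem apply_toLp_simpleFunc_eq_integral {p : ℝ≥0∞} [Fact (1 ≤ p)]
    {f : StrongDual ℝ (Lp ℝ p μ)} {g : X → ℝ} (hg : Integrable g μ)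
    (hfg : ∀ (s : Set X) (hs : MeasurableSet s),
      f (indicatorConstLp p hs (measure_ne_top μ _) (1 : ℝ)) = ∫ x in s, g x ∂μ)
    (h : SimpleFunc X ℝ) :
    f ((h.memLp_of_isFiniteMeasure p μ).toLp h) = ∫ x, g x * h x ∂μ := by
  have hgint (k : SimpleFunc X ℝ) : Integrable (fun x => g x * k x) μ := by
    obtain ⟨C, hC⟩ := k.exists_forall_norm_le
    exact hg.mul_bdd k.aestronglyMeasurable (Eventually.of_forall hC)
  induction h using SimpleFunc.induction with
  | const c hs =>
    rename_i s
    have hLp : (SimpleFunc.memLp_of_isFiniteMeasure (SimpleFunc.piecewise s hs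
        (SimpleFunc.const X c) (SimpleFunc.const X 0)) p μ).toLp _ =
        c • indicatorConstLp p hs (measure_ne_top μ _) (1 : ℝ) := by
      rw [indicatorConstLp, ← MemLp.toLp_const_smul, MemLp.toLp_eq_toLp_iff]
      refine Eventually.of_forall fun x => ?_
      by_cases hx : x ∈ s <;> simp [hx]
    rw [hLp, map_smul, hfg s hs, smul_eq_mul, ← integral_const_mul, ← integral_indicator hs]
    congr 1 with x
    by_cases hx : x ∈ s <;> simp [hx, mul_comm]
  | add hd hk hl =>
    rename_i k l
    have hLp : (SimpleFunc.memLp_of_isFiniteMeasure (k + l) p μ).toLp _ =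
        (k.memLp_of_isFiniteMeasure p μ).toLp k + (l.memLp_of_isFiniteMeasure p μ).toLp l := by
      rw [← MemLp.toLp_add, MemLp.toLp_eq_toLp_iff]
      exact Eventually.of_forall fun x => by simp
    rw [hLp, map_add, hk, hl, ← integral_add (hgint k) (hgint l)]
    simp [mul_add]

theorem memLp_of_forall_simpleFunc {p q : ℝ≥0∞} [Fact (1 ≤ p)]
    (hpq : p.toReal.HolderConjugate q.toReal)
    {f : StrongDual ℝ (Lp ℝ p μ)} {g : X → ℝ} (hgm : Measurable g) (hg : Integrable g μ)
    (hfg : ∀ h : SimpleFunc X ℝ,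
      f ((h.memLp_of_isFiniteMeasure p μ).toLp h) = ∫ x, g x * h x ∂μ) :
    MemLp g q μ := by
  have hp0 := hpq.pos
  have hq0 := hpq.symm.pos
  have hp0' : p ≠ 0 := by rintro rfl; simp at hp0
  have hq0' : q ≠ 0 := by rintro rfl; simp at hq0
  have hpt : p ≠ ∞ := by rintro rfl; simp at hp0
  have hqt : q ≠ ∞ := by rintro rfl; simp at hq0
  refine ⟨hgm.aestronglyMeasurable, ?_⟩
  rw [eLpNorm_lt_top_iff_lintegral_rpow_enorm_lt_top hq0' hqt]
  suffices H : ∫⁻ x, ‖g x‖ₑ ^ q.toReal ∂μ ≤ ENNReal.ofReal (‖f‖ ^ q.toReal) from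
    H.trans_lt ENNReal.ofReal_lt_top
  rw [lintegral_eq_nnreal]
  refine iSup₂_le fun ψ hψ => ?_
  have hψle (x : X) : (ψ x : ℝ) ^ (1 / q.toReal) ≤ |g x| := by
    have h := hψ x
    rw [enorm_eq_nnnorm, ← ENNReal.coe_rpow_of_nonneg _ hq0.le, ENNReal.coe_le_coe] at h
    have h' : (ψ x : ℝ) ≤ |g x| ^ q.toReal := by
      have := NNReal.coe_le_coe.2 h
      simpa using this
    calc (ψ x : ℝ) ^ (1 / q.toReal) ≤ (|g x| ^ q.toReal) ^ (1 / q.toReal) := by gcongr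
      _ = |g x| := by
        rw [← Real.rpow_mul (abs_nonneg _), mul_one_div_cancel hq0.ne', Real.rpow_one]
  let σ : SimpleFunc X ℝ := SimpleFunc.piecewise {x | 0 ≤ g x}
    (measurableSet_le measurable_const hgm) (SimpleFunc.const X 1) (SimpleFunc.const X (-1))
  let h : SimpleFunc X ℝ := σ * ψ.map fun t : NNReal => (t : ℝ) ^ (1 / p.toReal)
  have hσg (x : X) : g x * σ x = |g x| := by
    by_cases hx : 0 ≤ g x
    · simp [σ, hx, abs_of_nonneg hx]
    · simp [σ, hx, abs_of_neg (not_le.1 hx)]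
  have hσ (x : X) : |σ x| = 1 := by
    by_cases hx : 0 ≤ g x <;> simp [σ, hx]
  have hh (x : X) : |h x| = (ψ x : ℝ) ^ (1 / p.toReal) := by
    simp only [h, SimpleFunc.mul_apply, SimpleFunc.map_apply, abs_mul, hσ, one_mul]
    exact abs_of_nonneg (by positivity)
  let I : ℝ := ∫ x, (ψ x : ℝ) ∂μ
  have hψint : Integrable (fun x => (ψ x : ℝ)) μ := by
    simpa [Function.comp_def] using
      (ψ.map ((↑) : NNReal → ℝ)).integrable_of_isFiniteMeasure (μ := μ)
  have hI0 : 0 ≤ I := integral_nonneg fun x => NNReal.coe_nonneg _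
  have hnorm : ‖(h.memLp_of_isFiniteMeasure p μ).toLp h‖ = I ^ (1 / p.toReal) := by
    rw [Lp.norm_toLp, MemLp.eLpNorm_eq_integral_rpow_norm hp0' hpt
      (h.memLp_of_isFiniteMeasure p μ), ENNReal.toReal_ofReal (by positivity), one_div]
    congr 1
    refine integral_congr_ae (Eventually.of_forall fun x => ?_)
    simp only [Real.norm_eq_abs, hh]
    rw [← Real.rpow_mul (NNReal.coe_nonneg _), one_div_mul_cancel hp0.ne', Real.rpow_one]
  have hghint : Integrable (fun x => g x * h x) μ := by
    obtain ⟨C, hC⟩ := h.exists_forall_norm_le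
    exact hg.mul_bdd h.aestronglyMeasurable (Eventually.of_forall hC)
  have hle : I ≤ ‖f‖ * I ^ (1 / p.toReal) := by
    calc I ≤ ∫ x, g x * h x ∂μ := by
          refine integral_mono hψint hghint fun x => ?_
          have hx : g x * h x = |g x| * (ψ x : ℝ) ^ (1 / p.toReal) := by
            simp only [h, SimpleFunc.mul_apply, SimpleFunc.map_apply, ← mul_assoc, hσg]
          rw [hx]
          calc (ψ x : ℝ) = (ψ x : ℝ) ^ (1 / q.toReal) * (ψ x : ℝ) ^ (1 / p.toReal) := by
                rw [← Real.rpow_add_of_nonneg (NNReal.coe_nonneg _) (by positivity)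
                  (by positivity), one_div, one_div, add_comm, hpq.inv_add_inv_eq_one,
                  Real.rpow_one]
            _ ≤ _ := by gcongr; exact hψle x
      _ = f ((h.memLp_of_isFiniteMeasure p μ).toLp h) := (hfg h).symm
      _ ≤ ‖f‖ * I ^ (1 / p.toReal) := by
          rw [← hnorm]; exact (le_abs_self _).trans (f.le_opNorm _)
  have hIle : I ≤ ‖f‖ ^ q.toReal := by
    rcases hI0.eq_or_lt with h0 | hpos
    · rw [← h0]; positivity
    · have h1 : I ^ (1 / q.toReal) * I ^ (1 / p.toReal) ≤ ‖f‖ * I ^ (1 / p.toReal) := by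
        rwa [← Real.rpow_add hpos, one_div, one_div, add_comm, hpq.inv_add_inv_eq_one,
          Real.rpow_one, ← one_div]
      have h2 := le_of_mul_le_mul_right h1 (by positivity)
      calc I = (I ^ (1 / q.toReal)) ^ q.toReal := by
            rw [← Real.rpow_mul hI0, one_div_mul_cancel hq0.ne', Real.rpow_one]
        _ ≤ _ := by gcongr
  rw [← SimpleFunc.lintegral_eq_lintegral]
  calc ∫⁻ x, (ψ.map ((↑) : NNReal → ℝ≥0∞)) x ∂μ = ∫⁻ x, ENNReal.ofReal (ψ x) ∂μ := by simp
    _ = ENNReal.ofReal I := (ofReal_integral_eq_lintegral_ofReal hψint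
          (Eventually.of_forall fun x => NNReal.coe_nonneg _)).symm
    _ ≤ _ := ENNReal.ofReal_le_ofReal hIle

theorem exists_lpPairing_eq {p q : ℝ≥0∞} [Fact (1 ≤ p)] [Fact (1 ≤ q)] [p.HolderConjugate q]
    (hp : p ≠ ∞) (hq : q ≠ ∞) (f : StrongDual ℝ (Lp ℝ p μ)) :
    ∃ g : Lp ℝ q μ, ∀ u : Lp ℝ p μ,
      f u = (ContinuousLinearMap.mul ℝ ℝ).lpPairing μ p q u g := by
  obtain ⟨g, hgm, hg, hfg⟩ := exists_integrable_density hp f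
  have hsimple := apply_toLp_simpleFunc_eq_integral hg hfg
  have hgq : MemLp g q μ := memLp_of_forall_simpleFunc
    (ENNReal.HolderConjugate.toReal_of_ne_top hp hq) hgm hg hsimple
  refine ⟨hgq.toLp g, fun u => ?_⟩
  suffices H : f = ((ContinuousLinearMap.mul ℝ ℝ).lpPairing μ p q).flip (hgq.toLp g) by
    rw [H]; rfl
  refine ContinuousLinearMap.ext fun u => ?_
  refine (Lp.simpleFunc.denseRange hp).induction_on u
    (isClosed_eq f.continuous (ContinuousLinearMap.continuous _)) fun v => ?_
  have hv : (v : Lp ℝ p μ) =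
      ((Lp.simpleFunc.toSimpleFunc v).memLp_of_isFiniteMeasure p μ).toLp _ := by
    conv_lhs => rw [← Lp.simpleFunc.toLp_toSimpleFunc v]
  rw [hv, hsimple, ContinuousLinearMap.flip_apply, ContinuousLinearMap.lpPairing_eq_integral]
  refine integral_congr_ae ?_
  filter_upwards [hgq.coeFn_toLp,
    ((Lp.simpleFunc.toSimpleFunc v).memLp_of_isFiniteMeasure p μ).coeFn_toLp] with x h1 h2
  rw [h1, h2, ContinuousLinearMap.mul_apply', mul_comm]

theorem Lp.exists_weakly_convergent_subseq [IsSeparable μ] {p : ℝ≥0∞} [Fact (1 ≤ p)]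
    (hp1 : 1 < p) (hp2 : p ≠ ∞) {u : ℕ → Lp ℝ p μ} (hu : Bornology.IsBounded (Set.range u)) :
    ∃ (x : Lp ℝ p μ) (φ : ℕ → ℕ), StrictMono φ ∧
      ∀ f : StrongDual ℝ (Lp ℝ p μ), Tendsto (fun n => f (u (φ n))) atTop (nhds (f x)) := by
  let q := p.conjExponent
  have hpq : p.HolderConjugate q := .conjExponent hp1.le
  have hqp : q.HolderConjugate p := .symm
  have hq : q ≠ ∞ := ((ENNReal.HolderConjugate.lt_top_iff_one_lt q p).2 hp1).ne
  have : Fact (1 ≤ q) := ⟨ENNReal.HolderConjugate.one_le q p⟩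
  have : Fact (q ≠ ∞) := ⟨hq⟩
  let P := (ContinuousLinearMap.mul ℝ ℝ).lpPairing μ p q
  obtain ⟨C, hC⟩ := (P.lipschitz.isBounded_image hu).subset_closedBall 0
  obtain ⟨ψ, -, φ, hφ, hlim⟩ := WeakDual.isSeqCompact_closedBall ℝ (Lp ℝ q μ) 0 C
    (x := fun n => StrongDual.toWeakDual (P (u n)))
    (fun n => hC (Set.mem_image_of_mem _ (Set.mem_range_self n)))
  obtain ⟨x, hx⟩ := exists_lpPairing_eq (p := q) (q := p) hq hp2 (WeakDual.toStrongDual ψ)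
  refine ⟨x, φ, hφ, fun f => ?_⟩
  obtain ⟨g, hg⟩ := exists_lpPairing_eq hp2 hq f
  have hψ : ψ g = f x := by
    rw [hg, ContinuousLinearMap.lpPairing_eq_integral]
    refine (hx g).trans ?_
    rw [ContinuousLinearMap.lpPairing_eq_integral]
    simp only [ContinuousLinearMap.mul_apply', mul_comm]
  rw [← hψ]
  simp_rw [hg]
  exact ((WeakDual.eval_continuous g).tendsto ψ).comp hlim

end LpDuality

section WeakConvergence

theorem eventually_lt_norm_rpow_of_weak {E : Type*} [NormedAddCommGroup E] [NormedSpace ℝ E]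
    {v : ℕ → E} {x : E}
    (h : ∀ g : StrongDual ℝ E, Tendsto (fun n => g (v n)) atTop (nhds (g x)))
    {r c : ℝ} (hr : 0 < r) (hc : c < ‖x‖ ^ r) : ∀ᶠ n in atTop, c < ‖v n‖ ^ r := by
  rcases lt_or_ge c 0 with hneg | hpos
  · exact Eventually.of_forall fun n => hneg.trans_le (by positivity)
  · obtain ⟨g, hg1, hgx⟩ := exists_dual_vector'' ℝ x
    have hlt : c ^ r⁻¹ < g x := by
      rw [hgx]
      exact (Real.rpow_inv_lt_iff_of_pos hpos (norm_nonneg x) hr).2 hc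
    filter_upwards [(h g).eventually_const_lt hlt] with n hn
    refine (Real.rpow_inv_lt_iff_of_pos hpos (norm_nonneg _) hr).1 (hn.trans_le ?_)
    calc g (v n) ≤ ‖g‖ * ‖v n‖ := (le_abs_self _).trans (g.le_opNorm _)
      _ ≤ ‖v n‖ := mul_le_of_le_one_left (norm_nonneg _) hg1

theorem Convex.mem_of_weakly_tendsto {E : Type*} [NormedAddCommGroup E] [NormedSpace ℝ E]
    {D : Set E} (hconv : Convex ℝ D) (hclosed : IsClosed D) {v : ℕ → E} {x : E}
    (hv : ∀ n, v n ∈ D)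
    (h : ∀ g : StrongDual ℝ E, Tendsto (fun n => g (v n)) atTop (nhds (g x))) : x ∈ D := by
  by_contra hx
  obtain ⟨g, c, hlt, hgt⟩ := geometric_hahn_banach_closed_point hconv hclosed hx
  exact (le_of_tendsto' (h g) fun n => (hlt _ (hv n)).le).not_gt hgt

theorem Lp.exists_weakly_convergent_subseq_prod {X : Type*} [MeasurableSpace X] {μ : Measure X}
    [IsFiniteMeasure μ] [IsSeparable μ] {p : ℝ≥0∞} [Fact (1 ≤ p)] (hp1 : 1 < p) (hp2 : p ≠ ∞)
    {u : ℕ → Lp ℝ p μ × Lp ℝ p μ} (hu : Bornology.IsBounded (Set.range u)) :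
    ∃ (x : Lp ℝ p μ × Lp ℝ p μ) (φ : ℕ → ℕ), StrictMono φ ∧
      ∀ f : StrongDual ℝ (Lp ℝ p μ × Lp ℝ p μ),
        Tendsto (fun n => f (u (φ n))) atTop (nhds (f x)) := by
  obtain ⟨x, φ, hφ, hx⟩ := Lp.exists_weakly_convergent_subseq hp1 hp2
    (u := fun n => (u n).1) (hu.image_fst.subset (by rintro _ ⟨n, rfl⟩; exact ⟨_, ⟨n, rfl⟩, rfl⟩))
  obtain ⟨y, θ, hθ, hy⟩ := Lp.exists_weakly_convergent_subseq hp1 hp2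
    (u := fun n => (u (φ n)).2)
    (hu.image_snd.subset (by rintro _ ⟨n, rfl⟩; exact ⟨_, ⟨φ n, rfl⟩, rfl⟩))
  refine ⟨(x, y), φ ∘ θ, hφ.comp hθ, fun f => ?_⟩
  have hf (z : Lp ℝ p μ × Lp ℝ p μ) : f z = f.comp (.inl ℝ _ _) z.1 + f.comp (.inr ℝ _ _) z.2 := by
    simp [← map_add]
  simp_rw [hf]
  exact ((hx _).comp hθ.tendsto_atTop).add (hy _)

end WeakConvergence

/-- Stability of Tikhonov minimizers with respect to data perturbations.
Let `1 < p < ∞`, `𝓡 ⊂ ℝ³` of finite measure, and `X = L^p(𝓡) × L^p(𝓡)`.  Let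
`D ⊆ X` be closed, convex and bounded, `S : X → V` weakly sequentially continuous into
a Banach space `V`, `B : V → W` a bounded linear operator into a Banach space `W`,
`α > 0`, and exponents `q, pe ≥ 1`.  Let `𝓜ⁿ → 𝓜` in `W` and let `xⁿ ∈ D` minimize
`Jₙ(x) = ‖B S(x) - 𝓜ⁿ‖^q + α‖x - x₀‖^pe` over `D`.  Then a subsequence of `(xⁿ)`
converges weakly to a minimizer `x_α ∈ D` of `J(x) = ‖B S(x) - 𝓜‖^q + α‖x - x₀‖^pe`,
and along this subsequence `‖xⁿ - x₀‖ → ‖x_α - x₀‖`. -/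
theorem tikhonov_minimizer_stability
    (p : ℝ≥0∞) [Fact (1 ≤ p)] (hp1 : 1 < p) (hp2 : p ≠ ∞)
    (R : Set (EuclideanSpace ℝ (Fin 3))) (hR : Bornology.IsBounded R)
    (μ : Measure R) [IsFiniteMeasure μ]
    {V W : Type*}
    [NormedAddCommGroup V] [NormedSpace ℝ V] [CompleteSpace V]
    [NormedAddCommGroup W] [NormedSpace ℝ W] [CompleteSpace W]
    (D : Set (Lp ℝ p μ × Lp ℝ p μ))
    (hDne : D.Nonempty) (hDclosed : IsClosed D) (hDconv : Convex ℝ D)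
    (hDbdd : Bornology.IsBounded D)
    (S : Lp ℝ p μ × Lp ℝ p μ → V)
    -- weak sequential continuity of S
    (hS : ∀ (u : ℕ → Lp ℝ p μ × Lp ℝ p μ) (x : Lp ℝ p μ × Lp ℝ p μ),
      (∀ n, u n ∈ D) → x ∈ D →
      (∀ f : (Lp ℝ p μ × Lp ℝ p μ) →L[ℝ] ℝ, Tendsto (fun n => f (u n)) atTop (nhds (f x))) →
      ∀ g : V →L[ℝ] ℝ, Tendsto (fun n => g (S (u n))) atTop (nhds (g (S x))))
    (B : V →L[ℝ] W)
    (α : ℝ) (hα : 0 < α) (q pe : ℝ) (hq : 1 ≤ q) (hpe : 1 ≤ pe)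
    (x₀ : Lp ℝ p μ × Lp ℝ p μ)
    (𝓜n : ℕ → W) (𝓜 : W) (h𝓜 : Tendsto 𝓜n atTop (nhds 𝓜))
    (xn : ℕ → Lp ℝ p μ × Lp ℝ p μ) (hxnD : ∀ n, xn n ∈ D)
    (hxnmin : ∀ n, IsMinOn
      (fun x => ‖B (S x) - 𝓜n n‖ ^ q + α * ‖x - x₀‖ ^ pe) D (xn n)) :
    ∃ xα ∈ D, ∃ φ : ℕ → ℕ, StrictMono φ ∧
      IsMinOn (fun x => ‖B (S x) - 𝓜‖ ^ q + α * ‖x - x₀‖ ^ pe) D xα ∧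
      (∀ f : (Lp ℝ p μ × Lp ℝ p μ) →L[ℝ] ℝ,
        Tendsto (fun n => f (xn (φ n))) atTop (nhds (f xα))) ∧
      Tendsto (fun n => ‖xn (φ n) - x₀‖) atTop (nhds ‖xα - x₀‖) := by
  obtain ⟨xα, φ, hφ, hweak⟩ := Lp.exists_weakly_convergent_subseq_prod hp1 hp2
    (hDbdd.subset (Set.range_subset_iff.2 hxnD))
  have hxα : xα ∈ D := hDconv.mem_of_weakly_tendsto hDclosed (fun n => hxnD (φ n)) hweak
  have h𝓜φ : Tendsto (fun n => 𝓜n (φ n)) atTop (nhds 𝓜) := h𝓜.comp hφ.tendsto_atTop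
  have hq0 : 0 < q := by linarith
  have hpe0 : 0 < pe := by linarith
  have hres {c : ℝ} (hc : c < ‖B (S xα) - 𝓜‖ ^ q) :
      ∀ᶠ n in atTop, c < ‖B (S (xn (φ n))) - 𝓜n (φ n)‖ ^ q := by
    refine eventually_lt_norm_rpow_of_weak (fun g => ?_) hq0 hc
    simp only [map_sub]
    exact (hS _ xα (fun n => hxnD (φ n)) hxα hweak (g.comp B)).sub
      ((g.continuous.tendsto 𝓜).comp h𝓜φ)
  have hpen {c : ℝ} (hc : c < ‖xα - x₀‖ ^ pe) :
      ∀ᶠ n in atTop, c < ‖xn (φ n) - x₀‖ ^ pe := by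
    refine eventually_lt_norm_rpow_of_weak (fun g => ?_) hpe0 hc
    simp only [map_sub]
    exact (hweak g).sub_const _
  have hJ (x : Lp ℝ p μ × Lp ℝ p μ) :
      Tendsto (fun n => ‖B (S x) - 𝓜n (φ n)‖ ^ q + α * ‖x - x₀‖ ^ pe) atTop
        (nhds (‖B (S x) - 𝓜‖ ^ q + α * ‖x - x₀‖ ^ pe)) :=
    ((tendsto_const_nhds.sub h𝓜φ).norm.rpow_const (Or.inr hq0.le)).add_const _
  have hmin (n : ℕ) {x : Lp ℝ p μ × Lp ℝ p μ} (hx : x ∈ D) :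
      ‖B (S (xn (φ n))) - 𝓜n (φ n)‖ ^ q + α * ‖xn (φ n) - x₀‖ ^ pe ≤
        ‖B (S x) - 𝓜n (φ n)‖ ^ q + α * ‖x - x₀‖ ^ pe := isMinOn_iff.1 (hxnmin (φ n)) x hx
  refine ⟨xα, hxα, φ, hφ, isMinOn_iff.2 fun x hx => ?_, hweak, ?_⟩
  · refine le_of_forall_pos_lt_add fun ε hε => ?_
    obtain ⟨n, h1, h2, h3⟩ := ((hres (sub_lt_self _ (show 0 < ε / 3 by positivity))).and
      ((hpen (sub_lt_self _ (show 0 < ε / 3 / α by positivity))).and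
        ((hJ x).eventually_lt_const (lt_add_of_pos_right _ (show 0 < ε / 3 by positivity))))).exists
    have h4 := mul_lt_mul_of_pos_left h2 hα
    rw [mul_sub, mul_div_cancel₀ _ hα.ne'] at h4
    linarith [hmin n hx]
  · have hpow : Tendsto (fun n => ‖xn (φ n) - x₀‖ ^ pe) atTop (nhds (‖xα - x₀‖ ^ pe)) := by
      refine tendsto_order.2 ⟨fun c hc => hpen hc, fun c hc => ?_⟩
      have hδ : 0 < α * (c - ‖xα - x₀‖ ^ pe) / 2 := by
        have := sub_pos.2 hc
        positivity
      filter_upwards [hres (sub_lt_self _ hδ),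
        (hJ xα).eventually_lt_const (lt_add_of_pos_right _ hδ)] with n h1 h2
      refine lt_of_mul_lt_mul_left ?_ hα.le
      linarith [hmin n hxα]
    have hroot := hpow.rpow_const (p := pe⁻¹) (Or.inr (by positivity))
    simpa only [Real.rpow_rpow_inv (norm_nonneg _) hpe0.ne'] using hroot
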